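/- arXiv:0706.3981 — 2 statements merged into one kernel-verified Lean document; each statement's English description precedes it below -/
import Mathlib

section
/- Let n ≥ 1 and let α ∈ ℝⁿ satisfy a Diophantine condition: there exist constants C > 0 and γ > 0 such that |∑_{i=1}^n k_i α_i| ≥ C/‖k‖^γ for every nonzero k ∈ ℤⁿ. Then the constant vector field α on the torus 𝕋ⁿ = ℝⁿ/ℤⁿ is cohomology free: for every smooth ℤⁿ-periodic function f : ℝⁿ → ℝ there exist a constant c ∈ ℝ and a smooth ℤⁿ-periodic function u : ℝⁿ → ℝ such that Du(x)·α = f(x) − c for all x ∈ ℝⁿ, where Du(x)·α = ∑_{i=1}^n α_i ∂u/∂x_i (x) is the directional derivative of u along α. -/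
open MeasureTheory Set

/-- the real vector attached to an integer vector -/
def ivec {n : ℕ} (k : Fin n → ℤ) : Fin n → ℝ := fun i => (k i : ℝ)

/-- the linear form `x ↦ k · x` -/
noncomputable def lform {n : ℕ} (k : Fin n → ℤ) : (Fin n → ℝ) →L[ℝ] ℝ :=
  ∑ i, (k i : ℝ) • ContinuousLinearMap.proj (R := ℝ) (φ := fun _ : Fin n => ℝ) i

theorem lform_apply {n : ℕ} (k : Fin n → ℤ) (x : Fin n → ℝ) :
    lform k x = ∑ i, (k i : ℝ) * x i := by
  simp [lform]

theorem lform_neg {n : ℕ} (k : Fin n → ℤ) : lform (-k) = - lform k := by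
  ext x
  simp [lform_apply]

theorem lform_norm_le {n : ℕ} (k : Fin n → ℤ) : ‖lform k‖ ≤ n * ‖ivec k‖ := by
  refine ContinuousLinearMap.opNorm_le_bound _ (by positivity) fun x => ?_
  rw [lform_apply]
  refine (norm_sum_le _ _).trans ?_
  calc ∑ i, ‖(k i : ℝ) * x i‖ ≤ ∑ _i : Fin n, ‖ivec k‖ * ‖x‖ := by
        refine Finset.sum_le_sum fun i _ => ?_
        rw [norm_mul]
        gcongr
        · exact norm_le_pi_norm (ivec k) i
        · exact norm_le_pi_norm x i
    _ = n * ‖ivec k‖ * ‖x‖ := by simp [mul_assoc]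

/-- `t ↦ exp (2 π i t)` -/
noncomputable def e1 (t : ℝ) : ℂ := Complex.exp (2 * Real.pi * Complex.I * t)

theorem e1_hasDerivAt (t : ℝ) : HasDerivAt e1 (2 * Real.pi * Complex.I * e1 t) t := by
  have h : HasDerivAt (fun t : ℝ => 2 * Real.pi * Complex.I * (t : ℂ)) (2 * Real.pi * Complex.I) t := by
    simpa using (Complex.ofRealCLM.hasDerivAt (x := t)).const_mul (2 * Real.pi * Complex.I : ℂ)
  have := h.cexp
  exact this.congr_deriv (mul_comm _ _)

theorem e1_contDiff {N : WithTop ℕ∞} : ContDiff ℝ N e1 := by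
  unfold e1
  have : ContDiff ℝ N (fun t : ℝ => (t : ℂ)) := Complex.ofRealCLM.contDiff
  fun_prop

theorem e1_norm (t : ℝ) : ‖e1 t‖ = 1 := by
  have : e1 t = Complex.exp ((2 * Real.pi * t : ℝ) * Complex.I) := by
    unfold e1; congr 1; push_cast; ring
  rw [this, Complex.norm_exp_ofReal_mul_I]

theorem e1_iter (m : ℕ) : iteratedDeriv m e1 = fun t => (2 * Real.pi * Complex.I) ^ m * e1 t := by
  induction m with
  | zero => ext; simp
  | succ m ih =>
    rw [iteratedDeriv_succ, ih]
    ext t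
    rw [((e1_hasDerivAt t).const_mul _).deriv]
    ring

theorem e1_add_int (t : ℝ) (m : ℤ) : e1 (t + m) = e1 t := by
  unfold e1
  rw [Complex.exp_eq_exp_iff_exists_int]
  exact ⟨m, by push_cast; ring⟩

/-- the character `x ↦ exp (2 π i k·x)` -/
noncomputable def ch {n : ℕ} (k : Fin n → ℤ) (x : Fin n → ℝ) : ℂ := e1 (lform k x)

theorem ch_contDiff {n : ℕ} (k : Fin n → ℤ) {N : WithTop ℕ∞} : ContDiff ℝ N (ch k) :=
  e1_contDiff.comp (lform k).contDiff

theorem ch_norm {n : ℕ} (k : Fin n → ℤ) (x) : ‖ch k x‖ = 1 := e1_norm _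

theorem ch_periodic {n : ℕ} (k : Fin n → ℤ) (x : Fin n → ℝ) (l : Fin n → ℤ) :
    ch k (x + ivec l) = ch k x := by
  unfold ch
  rw [map_add, show lform k (ivec l) = ((∑ i, k i * l i : ℤ) : ℝ) by
    simp [lform_apply, ivec], e1_add_int]

theorem ch_hasFDerivAt {n : ℕ} (k : Fin n → ℤ) (x : Fin n → ℝ) :
    HasFDerivAt (ch k) ((lform k).smulRight (2 * Real.pi * Complex.I * ch k x)) x := by
  have h := (e1_hasDerivAt (lform k x)).hasFDerivAt.comp x (lform k).hasFDerivAt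
  refine h.congr_fderiv ?_
  ext v
  simp [ch]

theorem ch_iter {n : ℕ} (k : Fin n → ℤ) (m : ℕ) (x : Fin n → ℝ) :
    ‖iteratedFDeriv ℝ m (ch k) x‖ ≤ (2 * Real.pi * n) ^ m * ‖ivec k‖ ^ m := by
  have h := (lform k).iteratedFDeriv_comp_right (e1_contDiff (N := m)) x le_rfl
  change iteratedFDeriv ℝ m (ch k) x = _ at h
  rw [h]
  refine (ContinuousMultilinearMap.norm_compContinuousLinearMap_le _ _).trans ?_
  rw [norm_iteratedFDeriv_eq_norm_iteratedDeriv, e1_iter]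
  simp only [norm_mul, norm_pow, e1_norm, Finset.prod_const, Finset.card_univ, Fintype.card_fin]
  have : ‖(2:ℂ)‖ * ‖(Real.pi : ℂ)‖ * ‖Complex.I‖ = 2 * Real.pi := by
    simp [abs_of_pos Real.pi_pos]
  rw [this, mul_one, ← mul_pow, ← mul_pow, mul_assoc (2 * Real.pi)]
  gcongr
  exact lform_norm_le k

/-- periodicity -/
def Per {n : ℕ} (g : (Fin n → ℝ) → ℂ) : Prop := ∀ x (k : Fin n → ℤ), g (x + ivec k) = g x

theorem integral_partial_zero {n : ℕ} (g : (Fin (n+1) → ℝ) → ℂ) (hg : ContDiff ℝ 1 g) (hp : Per g)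
    (i : Fin (n+1)) : ∫ x in Icc (0 : Fin (n+1) → ℝ) 1, fderiv ℝ g x (Pi.single i 1) = 0 := by
  have hsum : ∀ x, (∑ j : Fin (n+1), (if j = i then fderiv ℝ g x else 0) (Pi.single j 1)) =
      fderiv ℝ g x (Pi.single i 1) := by
    intro x
    rw [Finset.sum_eq_single i] <;> simp +contextual
  have hcont : Continuous (fun x => fderiv ℝ g x (Pi.single i 1)) :=
    (hg.continuous_fderiv (by simp)).clm_apply continuous_const
  have := integral_divergence_of_hasFDerivAt_off_countable' (0 : Fin (n+1) → ℝ) 1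
    (by intro i; simp) (fun j => if j = i then g else 0)
    (fun j x => if j = i then fderiv ℝ g x else 0) ∅ countable_empty
    (fun j => by
      split_ifs
      · exact hg.continuous.continuousOn
      · exact continuousOn_const)
    (fun x _ j => by
      split_ifs
      · exact (hg.differentiable (by simp) x).hasFDerivAt
      · exact hasFDerivAt_const _ _)
    (by
      simp only [hsum]
      exact hcont.continuousOn.integrableOn_compact isCompact_Icc)
  simp only [hsum] at this
  rw [this]
  refine Finset.sum_eq_zero fun j _ => ?_
  split_ifs with h
  · subst h
    rw [sub_eq_zero]
    refine integral_congr_ae (Filter.Eventually.of_forall fun x => ?_)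
    dsimp only
    rw [← hp (j.insertNth ((0 : Fin (n+1) → ℝ) j) x) (Pi.single j 1)]
    congr 1
    ext l
    refine Fin.succAboveCases j ?_ (fun l => ?_) l
    · simp [ivec]
    · simp [ivec]
  · simp

/-- Fourier coefficient -/
noncomputable def cf {n : ℕ} (g : (Fin n → ℝ) → ℂ) (k : Fin n → ℤ) : ℂ :=
  ∫ x in Icc (0 : Fin n → ℝ) 1, ch (-k) x * g x

theorem cf_partial {n : ℕ} (g : (Fin (n+1) → ℝ) → ℂ) (hg : ContDiff ℝ 1 g) (hp : Per g)
    (i : Fin (n+1)) (k) :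
    cf (fun x => fderiv ℝ g x (Pi.single i 1)) k = 2 * Real.pi * Complex.I * k i * cf g k := by
  have h0 := integral_partial_zero (fun x => ch (-k) x * g x) ((ch_contDiff _).mul hg)
    (fun x l => by simp only [ch_periodic, hp x l]) i
  have hder : ∀ x, fderiv ℝ (fun x => ch (-k) x * g x) x (Pi.single i 1) =
      ch (-k) x * fderiv ℝ g x (Pi.single i 1) -
        2 * Real.pi * Complex.I * k i * (ch (-k) x * g x) := by
    intro x
    have := (ch_hasFDerivAt (-k) x).mul (hg.differentiable (by simp) x).hasFDerivAt
    rw [show (fun x => ch (-k) x * g x) = ch (-k) * g from rfl, this.fderiv]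
    simp [lform_apply, Pi.single_apply]
    ring
  have hc : Continuous (ch (-k)) := (ch_contDiff (N := 0) (-k)).continuous
  have hcont : Continuous (fun x => fderiv ℝ g x (Pi.single i 1)) :=
    (hg.continuous_fderiv (by simp)).clm_apply continuous_const
  simp only [hder] at h0
  rw [integral_sub, integral_const_mul, sub_eq_zero] at h0
  · exact h0
  · exact (hc.mul hcont).continuousOn.integrableOn_compact isCompact_Icc
  · exact (continuous_const.mul (hc.mul hg.continuous)).continuousOn.integrableOn_compact isCompact_Icc

theorem per_partial {n : ℕ} (g : (Fin n → ℝ) → ℂ) (hp : Per g) (v) :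
    Per (fun x => fderiv ℝ g x v) := by
  intro x k
  dsimp only
  rw [← fderiv_comp_add_right]
  congr 2
  ext y
  exact hp y k

theorem cf_decay_i {n : ℕ} (i : Fin (n+1)) (N : ℕ) : ∀ (g : (Fin (n+1) → ℝ) → ℂ),
    ContDiff ℝ (⊤ : ℕ∞) g → Per g → ∃ B, ∀ k : Fin (n+1) → ℤ, |(k i : ℝ)| ^ N * ‖cf g k‖ ≤ B := by
  induction N with
  | zero =>
    intro g hg hp
    refine ⟨∫ x in Icc (0 : Fin (n+1) → ℝ) 1, ‖g x‖, fun k => ?_⟩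
    rw [pow_zero, one_mul]
    refine (norm_integral_le_integral_norm _).trans (le_of_eq ?_)
    simp [ch_norm]
  | succ N ih =>
    intro g hg hp
    obtain ⟨B, hB⟩ := ih (fun x => fderiv ℝ g x (Pi.single i 1))
      ((hg.fderiv_right (m := (⊤ : ℕ∞)) (by simp)).clm_apply contDiff_const) (per_partial g hp _)
    refine ⟨B, fun k => le_trans ?_ (hB k)⟩
    rw [cf_partial g (hg.of_le (by exact_mod_cast le_top)) hp]
    have h1 : ‖(2 * Real.pi * Complex.I * k i * cf g k : ℂ)‖ = 2 * Real.pi * (|(k i : ℝ)| * ‖cf g k‖) := by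
      simp [abs_of_pos Real.pi_pos]
      ring
    rw [h1, pow_succ, mul_assoc]
    refine mul_le_mul_of_nonneg_left ?_ (pow_nonneg (abs_nonneg _) _)
    have : (1:ℝ) ≤ 2 * Real.pi := by linarith [Real.pi_gt_three]
    exact le_mul_of_one_le_left (mul_nonneg (abs_nonneg _) (norm_nonneg (cf g k))) this

theorem cf_decay {n : ℕ} (N : ℕ) (g : (Fin (n+1) → ℝ) → ℂ)
    (hg : ContDiff ℝ (⊤ : ℕ∞) g) (hp : Per g) :
    ∃ B, ∀ k : Fin (n+1) → ℤ, ‖ivec k‖ ^ N * ‖cf g k‖ ≤ B := by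
  choose B hB using fun i => cf_decay_i i N g hg hp
  have hB0 : ∀ i, 0 ≤ B i := fun i => le_trans (by positivity) (hB i 0)
  refine ⟨∑ i, B i, fun k => ?_⟩
  obtain ⟨i, hi⟩ := Finite.exists_max (fun i => ‖ivec k i‖)
  have : ‖ivec k‖ ≤ |(k i : ℝ)| := (pi_norm_le_iff_of_nonneg (abs_nonneg _)).2 hi
  calc ‖ivec k‖ ^ N * ‖cf g k‖ ≤ |(k i : ℝ)| ^ N * ‖cf g k‖ := by gcongr
    _ ≤ B i := hB i k
    _ ≤ _ := Finset.single_le_sum (fun i _ => hB0 i) (Finset.mem_univ i)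

theorem ivec_norm_ge {n : ℕ} (k : Fin n → ℤ) (hk : k ≠ 0) : 1 ≤ ‖ivec k‖ := by
  obtain ⟨i, hi⟩ := Function.ne_iff.1 hk
  refine le_trans ?_ (norm_le_pi_norm (ivec k) i)
  have : (1:ℤ) ≤ |k i| := Int.one_le_abs hi
  simp only [ivec, Real.norm_eq_abs]
  exact_mod_cast this

theorem summable_ivec (n : ℕ) : ∃ R : ℕ, Summable fun k : Fin n → ℤ => (‖ivec k‖ ^ R)⁻¹ := by
  let L := Submodule.span ℤ (Set.range (Pi.basisFun ℝ (Fin n)))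
  refine ⟨Module.finrank ℤ L + 1, ?_⟩
  have h := ZLattice.summable_norm_rpow L (-(Module.finrank ℤ L + 1 : ℕ)) (by push_cast; linarith)
  have hmem : ∀ k : Fin n → ℤ, ivec k ∈ L := by
    intro k
    rw [Module.Basis.mem_span_iff_repr_mem]
    intro i
    exact ⟨k i, by simp [ivec]⟩
  have hinj : Function.Injective (fun k : Fin n → ℤ => (⟨ivec k, hmem k⟩ : L)) := by
    intro k l hkl
    have := congrArg Subtype.val hkl
    ext i
    have := congrFun this i
    simpa [ivec] using this
  refine (h.comp_injective hinj).congr fun k => ?_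
  simp only [Function.comp]
  rw [Real.rpow_neg (norm_nonneg _), Real.rpow_natCast]
  rfl

theorem summable_of_decay {n : ℕ} (a : (Fin n → ℤ) → ℂ)
    (h : ∀ N : ℕ, ∃ B, ∀ k, ‖ivec k‖ ^ N * ‖a k‖ ≤ B) (m : ℕ) :
    Summable fun k => ‖a k‖ * ‖ivec k‖ ^ m := by
  obtain ⟨R, hR⟩ := summable_ivec n
  obtain ⟨B, hB⟩ := h (m + R)
  refine Summable.of_norm_bounded_eventually (hR.mul_left B) ?_
  refine (Set.finite_singleton (0 : Fin n → ℤ)).subset fun k hk => ?_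
  by_contra hk0
  apply hk
  have h1 := ivec_norm_ge k hk0
  have h2 := hB k
  change ‖‖a k‖ * ‖ivec k‖ ^ m‖ ≤ B * (‖ivec k‖ ^ R)⁻¹
  rw [Real.norm_of_nonneg (by positivity), ← div_eq_mul_inv, le_div_iff₀ (by positivity)]
  refine le_trans (le_of_eq ?_) h2
  rw [pow_add]; ring

theorem fourier_series {n : ℕ} (g : (Fin n → ℝ) → ℂ) (hg : Continuous g) (hp : Per g)
    (hs : Summable (cf g)) (x : Fin n → ℝ) : HasSum (fun k => cf g k * ch k x) (g x) := by
  let q : C(Fin n → ℝ, UnitAddTorus (Fin n)) :=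
    ⟨Pi.map (fun _ => ((↑) : ℝ → UnitAddCircle)), by
      exact Continuous.piMap fun _ => AddCircle.continuous_mk' 1⟩
  have hq : Topology.IsQuotientMap q :=
    (IsOpenQuotientMap.piMap (fun _ => QuotientAddGroup.isOpenQuotientMap_mk)).isQuotientMap
  have hfac : Function.FactorsThrough (⟨g, hg⟩ : C(Fin n → ℝ, ℂ)) q := by
    intro a b hab
    have : ∀ i, ∃ m : ℤ, b i + m = a i := by
      intro i
      have h1 : ((a i : ℝ) : UnitAddCircle) = (b i : ℝ) := congrFun hab i
      rw [← sub_eq_zero, ← AddCircle.coe_sub, AddCircle.coe_eq_zero_iff] at h1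
      obtain ⟨m, hm⟩ := h1
      refine ⟨m, ?_⟩
      rw [zsmul_eq_mul, mul_one] at hm
      linarith
    choose m hm using this
    have : a = b + ivec m := by ext i; simp [ivec, hm]
    change g a = g b
    rw [this, hp]
  let F := hq.lift ⟨g, hg⟩ hfac
  have hF : ∀ y, F (q y) = g y := fun y => DFunLike.congr_fun (hq.lift_comp ⟨g, hg⟩ hfac) y
  have hch : ∀ k y, UnitAddTorus.mFourier k (q y) = ch k y := by
    intro k y
    simp only [UnitAddTorus.mFourier, ContinuousMap.coe_mk, q, Pi.map, fourier_coe_apply, ch, e1,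
      lform_apply]
    rw [← Complex.exp_sum]
    congr 1
    push_cast
    rw [Finset.mul_sum]
    refine Finset.sum_congr rfl fun i _ => ?_
    ring
  have hcf : UnitAddTorus.mFourierCoeff F = cf g := by
    ext k
    rw [UnitAddTorus.mFourierCoeff_eq_integral _ _ 0, cf]
    have hset : {x : Fin n → ℝ | ∀ i, x i ∈ Ioc ((0 : Fin n → ℝ) i) ((0 : Fin n → ℝ) i + 1)} =
      Set.univ.pi fun i => Ioc ((0 : Fin n → ℝ) i) ((1 : Fin n → ℝ) i) := by
      ext; simp
    rw [hset]
    refine (setIntegral_congr_set Measure.univ_pi_Ioc_ae_eq_Icc).trans ?_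
    refine integral_congr_ae (Filter.Eventually.of_forall fun y => ?_)
    have := hch (-k) y
    have h2 := hF y
    change UnitAddTorus.mFourier (-k) (q y) • F (q y) = _
    rw [this, h2, smul_eq_mul]
  have := UnitAddTorus.hasSum_mFourier_series_apply_of_summable (f := F) (by rw [hcf]; exact hs) (q x)
  simpa only [hcf, hch, hF, smul_eq_mul] using this

theorem stmt13 (n : ℕ) (hn : 1 ≤ n) (α : Fin n → ℝ)
    (C γ : ℝ) (hC : 0 < C) (hγ : 0 < γ)
    (hdio : ∀ k : Fin n → ℤ, k ≠ 0 →
      C / ‖((fun i => (k i : ℝ)) : Fin n → ℝ)‖ ^ γ ≤ |∑ i, (k i : ℝ) * α i|) :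
    ∀ f : (Fin n → ℝ) → ℝ, ContDiff ℝ (⊤ : ℕ∞) f →
      (∀ (x : Fin n → ℝ) (k : Fin n → ℤ), f (x + fun i => (k i : ℝ)) = f x) →
      ∃ c : ℝ, ∃ u : (Fin n → ℝ) → ℝ, ContDiff ℝ (⊤ : ℕ∞) u ∧
        (∀ (x : Fin n → ℝ) (k : Fin n → ℤ), u (x + fun i => (k i : ℝ)) = u x) ∧
        ∀ x, fderiv ℝ u x α = f x - c := by
  intro f hf hper
  obtain ⟨d, rfl⟩ : ∃ d, n = d + 1 := ⟨n - 1, by omega⟩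
  let g : (Fin (d+1) → ℝ) → ℂ := fun x => (f x : ℂ)
  have hg : ContDiff ℝ (⊤ : ℕ∞) g := Complex.ofRealCLM.contDiff.comp hf
  have hgp : Per g := fun x k => by
    have := hper x k
    simp only [g]
    exact_mod_cast this
  have hlow : ∀ k : Fin (d+1) → ℤ, k ≠ 0 → C / ‖ivec k‖ ^ γ ≤ |lform k α| := by
    intro k hk
    rw [lform_apply]
    exact hdio k hk
  have hne : ∀ k : Fin (d+1) → ℤ, k ≠ 0 → 0 < |lform k α| := fun k hk =>
    lt_of_lt_of_le (div_pos hC (Real.rpow_pos_of_pos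
      (lt_of_lt_of_le one_pos (ivec_norm_ge k hk)) _)) (hlow k hk)
  have hcs : Summable (cf g) := by
    have := summable_of_decay (cf g) (fun N => cf_decay N g hg hgp) 0
    simp only [pow_zero, mul_one] at this
    exact this.of_norm
  let a : (Fin (d+1) → ℤ) → ℂ := fun k => cf g k / (2 * Real.pi * Complex.I * (lform k α : ℝ))
  have hl0 : lform (0 : Fin (d+1) → ℤ) α = 0 := by simp [lform_apply]
  have ha0 : a 0 = 0 := by simp [a, hl0]
  have hadec : ∀ N : ℕ, ∃ B, ∀ k, ‖ivec k‖ ^ N * ‖a k‖ ≤ B := by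
    intro N
    obtain ⟨G, hG⟩ := exists_nat_ge γ
    obtain ⟨B, hB⟩ := cf_decay (N + G) g hg hgp
    have hB0 : 0 ≤ B := le_trans (by positivity) (hB 0)
    refine ⟨B / C, fun k => ?_⟩
    by_cases hk : k = 0
    · rw [hk, ha0]; simp; positivity
    have h1 := ivec_norm_ge k hk
    have h2 := hlow k hk
    have h3 := hne k hk
    have hpos : 0 < ‖ivec k‖ ^ γ := Real.rpow_pos_of_pos (by linarith) _
    have h4 : ‖ivec k‖ ^ γ ≤ ‖ivec k‖ ^ G := by
      rw [← Real.rpow_natCast]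
      exact Real.rpow_le_rpow_of_exponent_le h1 hG
    have hna : ‖a k‖ = ‖cf g k‖ / (2 * Real.pi * |lform k α|) := by
      simp [a, abs_of_pos Real.pi_pos]
    have h5 : C ≤ |lform k α| * ‖ivec k‖ ^ G := by
      rw [div_le_iff₀ hpos] at h2
      exact h2.trans (by gcongr)
    have h6 : C ≤ 2 * Real.pi * |lform k α| * ‖ivec k‖ ^ G := by
      rw [mul_assoc]
      exact h5.trans (le_mul_of_one_le_left (by positivity) (by linarith [Real.pi_gt_three]))
    rw [hna, mul_div_assoc', div_le_div_iff₀ (by positivity) hC]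
    calc ‖ivec k‖ ^ N * ‖cf g k‖ * C
        ≤ ‖ivec k‖ ^ N * ‖cf g k‖ * (2 * Real.pi * |lform k α| * ‖ivec k‖ ^ G) := by gcongr
      _ = (‖ivec k‖ ^ (N + G) * ‖cf g k‖) * (2 * Real.pi * |lform k α|) := by rw [pow_add]; ring
      _ ≤ B * (2 * Real.pi * |lform k α|) := by gcongr; exact hB k
  have hasum := summable_of_decay a hadec
  let U : (Fin (d+1) → ℝ) → ℂ := fun x => ∑' k, a k * ch k x
  have hU : ContDiff ℝ (⊤ : ℕ∞) U := by
    refine contDiff_tsum (v := fun m k => (2 * Real.pi * (d+1 : ℕ)) ^ m * (‖a k‖ * ‖ivec k‖ ^ m))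
      (fun k => contDiff_const.mul (ch_contDiff k)) (fun m _ => (hasum m).mul_left _) ?_
    intro m k x _
    have : iteratedFDeriv ℝ m (fun x => a k * ch k x) x = a k • iteratedFDeriv ℝ m (ch k) x :=
      iteratedFDeriv_const_smul_apply (a := a k) (f := ch k) (ch_contDiff k).contDiffAt
    rw [this, norm_smul]
    calc ‖a k‖ * ‖iteratedFDeriv ℝ m (ch k) x‖ ≤ ‖a k‖ * ((2 * Real.pi * (d+1 : ℕ)) ^ m * ‖ivec k‖ ^ m) := by
          gcongr; exact ch_iter k m x
      _ = _ := by ring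
  have hUd : ∀ x, fderiv ℝ U x α = g x - cf g 0 := by
    intro x
    let D : (Fin (d+1) → ℤ) → (Fin (d+1) → ℝ) → ((Fin (d+1) → ℝ) →L[ℝ] ℂ) := fun k x =>
      a k • (lform k).smulRight (2 * Real.pi * Complex.I * ch k x)
    have hb : ∀ k x, ‖D k x‖ ≤ (2 * Real.pi * (d+1 : ℕ)) * (‖a k‖ * ‖ivec k‖ ^ 1) := by
      intro k x
      simp only [D, norm_smul, ContinuousLinearMap.norm_smulRight_apply, norm_mul, ch_norm]
      have := lform_norm_le k
      have h2 : ‖(2:ℂ)‖ * ‖(Real.pi : ℂ)‖ * ‖Complex.I‖ * 1 = 2 * Real.pi := by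
        simp [abs_of_pos Real.pi_pos]
      rw [h2]
      calc ‖a k‖ * (‖lform k‖ * (2 * Real.pi)) ≤ ‖a k‖ * (((d+1 : ℕ) * ‖ivec k‖) * (2 * Real.pi)) := by
            gcongr
        _ = _ := by ring
    have hus := (hasum 1).mul_left (2 * Real.pi * (d+1 : ℕ))
    have hfd : HasFDerivAt U (∑' k, D k x) x := by
      refine hasFDerivAt_tsum (x₀ := 0) hus
        (fun k y => (ch_hasFDerivAt k y).const_smul (a k)) hb ?_ x
      have := hasum 0
      refine Summable.of_norm (this.congr fun k => ?_)
      simp [ch_norm]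
    have hDs : Summable fun k => D k x := Summable.of_norm_bounded hus fun k => hb k x
    have hmap := (ContinuousLinearMap.apply ℝ ℂ α).map_tsum hDs
    simp only [ContinuousLinearMap.apply_apply] at hmap
    rw [hfd.fderiv, hmap]
    have hfs := fourier_series g hg.continuous hgp hcs x
    have hsub := hfs.sub (hasSum_ite_eq (0 : Fin (d+1) → ℤ) (cf g 0))
    rw [← hsub.tsum_eq]
    refine tsum_congr fun k => ?_
    by_cases hk : k = 0
    · subst hk
      simp [D, ha0, ch, e1, lform_apply]
    · have hl : (lform k α : ℂ) ≠ 0 := by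
        have := abs_pos.1 (hne k hk)
        exact_mod_cast this
      have hpi : (Real.pi : ℂ) ≠ 0 := by exact_mod_cast Real.pi_ne_zero
      simp [D, hk, a]
      field_simp
  refine ⟨(cf g 0).re, fun x => (U x).re, Complex.reCLM.contDiff.comp hU, fun x k => ?_, fun x => ?_⟩
  · have : U (x + ivec k) = U x := by simp only [U, ch_periodic]
    exact congrArg Complex.re this
  · have h1 := Complex.reCLM.hasFDerivAt.comp x (hU.differentiable (by simp) x).hasFDerivAt
    have h2 : HasFDerivAt (fun x => (U x).re) _ x := h1
    rw [h2.fderiv]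
    simp [hUd, g]
end

section
/- Let n ≥ 1 and α ∈ ℝⁿ. Suppose the constant vector field α on the torus 𝕋ⁿ = ℝⁿ/ℤⁿ is cohomology free: for every smooth ℤⁿ-periodic function f : ℝⁿ → ℝ there exist a constant c ∈ ℝ and a smooth ℤⁿ-periodic function u : ℝⁿ → ℝ with Du(x)·α = f(x) − c for all x ∈ ℝⁿ. Then α is Diophantine: there exist constants C > 0 and γ > 0 such that |∑_{i=1}^n k_i α_i| ≥ C/‖k‖^γ for every nonzero k ∈ ℤⁿ. -/
open Filter Topology

lemma mean_cos (w : ℝ) : Tendsto (fun T : ℝ => T⁻¹ * ∫ t in (0:ℝ)..T, Real.cos (w * t)) atTop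
    (𝓝 (if w = 0 then 1 else 0)) := by
  split_ifs with h
  · subst h
    refine tendsto_const_nhds.congr' ?_
    filter_upwards [eventually_gt_atTop 0] with T hT
    simp [hT.ne']
  · have h1 : ∀ T : ℝ, ∫ t in (0:ℝ)..T, Real.cos (w * t) = w⁻¹ * Real.sin (w * T) := by
      intro T
      rw [intervalIntegral.integral_comp_mul_left (fun t => Real.cos t) h]
      simp
    simp_rw [h1]
    refine squeeze_zero_norm' (a := fun T : ℝ => T⁻¹ * |w⁻¹|) ?_ ?_
    · filter_upwards [eventually_gt_atTop 0] with T hT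
      rw [norm_mul, norm_mul, Real.norm_eq_abs, Real.norm_eq_abs, Real.norm_eq_abs, abs_of_pos (inv_pos.2 hT)]
      gcongr
      exact mul_le_of_le_one_right (abs_nonneg _) (Real.abs_sin_le_one _)
    · simpa using tendsto_inv_atTop_zero.mul_const |w⁻¹|

lemma mean_cos_cos (a b : ℝ) : ∃ L : ℝ, 0 ≤ L ∧ (a = b → 1 / 2 ≤ L) ∧
    Tendsto (fun T : ℝ => T⁻¹ * ∫ t in (0:ℝ)..T, Real.cos (a * t) * Real.cos (b * t)) atTop (𝓝 L) := by
  refine ⟨((if a - b = 0 then 1 else 0) + (if a + b = 0 then 1 else 0)) / 2, by positivity, ?_, ?_⟩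
  · intro h
    have : a - b = 0 := sub_eq_zero.2 h
    rw [if_pos this]
    have : (0:ℝ) ≤ if a + b = 0 then 1 else 0 := by positivity
    linarith
  · refine (((mean_cos (a - b)).add (mean_cos (a + b))).div_const 2).congr fun T => ?_
    rw [← mul_add, ← intervalIntegral.integral_add
      (Continuous.intervalIntegrable (by fun_prop) _ _) (Continuous.intervalIntegrable (by fun_prop) _ _),
      mul_div_assoc, ← intervalIntegral.integral_div]
    congr 2
    ext t
    rw [sub_mul, add_mul, Real.cos_sub, Real.cos_add]
    ring

lemma key (a : ℕ → ℝ) (ha : ∀ m, 0 ≤ a m) (hs : Summable a) (w : ℕ → ℝ) (c M : ℝ) (v : ℝ → ℝ)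
    (hv : ∀ t, HasDerivAt v ((∑' m, a m * Real.cos (w m * t)) - c) t)
    (hM : ∀ t, |v t| ≤ M) (m : ℕ) (hm : w m ≠ 0) : a m / 2 ≤ |w m| * M := by
  choose L hL0 hL1 hL using fun j => mean_cos_cos (w j) (w m)
  set S : ℝ → ℝ := fun t => ∑' m, a m * Real.cos (w m * t) with hS
  have hb : ∀ j t, ‖a j * Real.cos (w j * t)‖ ≤ a j := fun j t => by
    rw [norm_mul, Real.norm_eq_abs, Real.norm_eq_abs, abs_of_nonneg (ha j)]
    exact mul_le_of_le_one_right (ha j) (Real.abs_cos_le_one _)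
  have hSc : Continuous S := continuous_tsum (fun j => by fun_prop) hs hb
  have hvc : Continuous v := continuous_iff_continuousAt.2 fun t => (hv t).continuousAt
  -- interchange
  have hint : ∀ T : ℝ, HasSum (fun j => a j * ∫ t in (0:ℝ)..T, Real.cos (w j * t) * Real.cos (w m * t))
      (∫ t in (0:ℝ)..T, S t * Real.cos (w m * t)) := by
    intro T
    have := intervalIntegral.hasSum_integral_of_dominated_convergence
      (μ := MeasureTheory.volume) (a := 0) (b := T)
      (F := fun j t => a j * Real.cos (w j * t) * Real.cos (w m * t))
      (f := fun t => S t * Real.cos (w m * t)) (fun j _ => a j)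
      (fun j => (Continuous.aestronglyMeasurable (by fun_prop)))
      (fun j => Eventually.of_forall fun t _ => by
        rw [norm_mul]
        exact (mul_le_of_le_one_right (norm_nonneg _) (Real.abs_cos_le_one _)).trans (hb j t))
      (Eventually.of_forall fun t _ => hs) (by simp)
      (Eventually.of_forall fun t _ => by
        exact ((Summable.of_norm_bounded hs (fun j => hb j t)).hasSum).mul_right _)
    refine this.congr_fun ?_ |> fun h => h
    intro j
    simp_rw [mul_assoc]
    rw [intervalIntegral.integral_const_mul]
  have hlim : Tendsto (fun T : ℝ => T⁻¹ * ∫ t in (0:ℝ)..T, S t * Real.cos (w m * t)) atTop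
      (𝓝 (∑' j, a j * L j)) := by
    have : Tendsto (fun T : ℝ => ∑' j, a j * (T⁻¹ * ∫ t in (0:ℝ)..T, Real.cos (w j * t) * Real.cos (w m * t)))
        atTop (𝓝 (∑' j, a j * L j)) := by
      refine tendsto_tsum_of_dominated_convergence hs (fun j => (hL j).const_mul _) ?_
      filter_upwards [eventually_gt_atTop 0] with T hT j
      rw [norm_mul, Real.norm_eq_abs, abs_of_nonneg (ha j)]
      refine mul_le_of_le_one_right (ha j) ?_
      have := intervalIntegral.norm_integral_le_of_norm_le_const (a := 0) (b := T) (C := 1)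
        (f := fun t => Real.cos (w j * t) * Real.cos (w m * t)) (fun t _ => by
          rw [norm_mul]
          exact mul_le_one₀ (Real.abs_cos_le_one _) (norm_nonneg _) (Real.abs_cos_le_one _))
      rw [sub_zero, one_mul, abs_of_pos hT] at this
      rw [norm_mul, norm_inv, Real.norm_eq_abs T, abs_of_pos hT, inv_mul_le_iff₀ hT, mul_one]
      exact this
    refine this.congr fun T => ?_
    rw [← (hint T).tsum_eq, ← tsum_mul_left]
    congr 1
    ext j
    ring
  have hpos : a m / 2 ≤ ∑' j, a j * L j := by
    by_cases hsum : Summable (fun j => a j * L j)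
    · have h1 := hsum.le_tsum m (fun j _ => mul_nonneg (ha j) (hL0 j))
      have h2 := mul_le_mul_of_nonneg_left (hL1 m rfl) (ha m)
      linarith
    · exfalso
      apply hsum
      refine Summable.of_nonneg_of_le (fun j => mul_nonneg (ha j) (hL0 j)) (fun j => ?_) hs
      refine mul_le_of_le_one_right (ha j) ?_
      refine le_of_tendsto (hL j) ?_
      filter_upwards [eventually_gt_atTop 0] with T hT
      have := intervalIntegral.norm_integral_le_of_norm_le_const (a := 0) (b := T) (C := 1)
        (f := fun t => Real.cos (w j * t) * Real.cos (w m * t)) (fun t _ => by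
          rw [norm_mul]
          exact mul_le_one₀ (Real.abs_cos_le_one _) (norm_nonneg _) (Real.abs_cos_le_one _))
      rw [sub_zero, one_mul, abs_of_pos hT] at this
      rw [inv_mul_le_iff₀ hT, mul_one]
      exact (le_abs_self _).trans this
  have hmc := mean_cos (w m)
  rw [if_neg hm] at hmc
  have hlim2 := hlim.sub (hmc.const_mul c)
  have hlim3 : Tendsto (fun T : ℝ => T⁻¹ * (2 * M) + |w m| * M) atTop (𝓝 (0 * (2 * M) + |w m| * M)) :=
    (tendsto_inv_atTop_zero.mul_const _).add_const _
  have := le_of_tendsto_of_tendsto hlim2 hlim3 ?_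
  · simp only [mul_zero, sub_zero, zero_mul, zero_add] at this
    exact hpos.trans this
  filter_upwards [eventually_gt_atTop 0] with T hT
  have hparts := intervalIntegral.integral_mul_deriv_eq_deriv_mul (a := 0) (b := T)
    (u := fun t => Real.cos (w m * t)) (u' := fun t => -Real.sin (w m * t) * w m)
    (v := v) (v' := fun t => S t - c)
    (fun t _ => by
      have := ((hasDerivAt_id t).const_mul (w m)).cos
      simpa using this) (fun t _ => hv t)
    (Continuous.intervalIntegrable (by fun_prop) _ _) (Continuous.intervalIntegrable (by fun_prop) _ _)
  have hE : ∫ t in (0:ℝ)..T, Real.cos (w m * t) * (S t - c) =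
      (∫ t in (0:ℝ)..T, S t * Real.cos (w m * t)) - c * ∫ t in (0:ℝ)..T, Real.cos (w m * t) := by
    rw [← intervalIntegral.integral_const_mul, ← intervalIntegral.integral_sub
      (Continuous.intervalIntegrable (by fun_prop) _ _) (Continuous.intervalIntegrable (by fun_prop) _ _)]
    congr 1
    ext t
    ring
  have hI := intervalIntegral.norm_integral_le_of_norm_le_const (a := 0) (b := T) (C := |w m| * M)
        (f := fun t => -Real.sin (w m * t) * w m * v t) (fun t _ => by
          rw [norm_mul, norm_mul, norm_neg]
          exact mul_le_mul (mul_le_of_le_one_left (abs_nonneg _) (Real.abs_sin_le_one _)) (hM t)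
            (abs_nonneg _) (abs_nonneg _))
  rw [sub_zero, abs_of_pos hT] at hI
  have hI' := (abs_le.1 hI).1
  have hM0 := (abs_nonneg _).trans (hM 0)
  have hA : Real.cos (w m * T) * v T ≤ M := (le_abs_self _).trans (by
    rw [abs_mul]; exact (mul_le_of_le_one_left (abs_nonneg _) (Real.abs_cos_le_one _)).trans (hM T))
  have hB := (abs_le.1 (hM 0)).1
  rw [hE] at hparts
  simp only [mul_zero, Real.cos_zero, one_mul] at hparts
  have : T⁻¹ * (∫ t in (0:ℝ)..T, S t * Real.cos (w m * t)) - c * (T⁻¹ * ∫ t in (0:ℝ)..T, Real.cos (w m * t))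
      = T⁻¹ * ((∫ t in (0:ℝ)..T, S t * Real.cos (w m * t)) - c * ∫ t in (0:ℝ)..T, Real.cos (w m * t)) := by ring
  rw [this, hparts, inv_mul_le_iff₀ hT, mul_add, ← mul_assoc T, mul_inv_cancel₀ hT.ne']
  linarith

lemma bdd_periodic (n : ℕ) (u : (Fin n → ℝ) → ℝ) (hu : Continuous u)
    (hp : ∀ (x : Fin n → ℝ) (k : Fin n → ℤ), u (x + fun i => (k i : ℝ)) = u x) :
    ∃ M, ∀ x, |u x| ≤ M := by
  obtain ⟨M, hM⟩ := (isCompact_Icc (a := (0 : Fin n → ℝ)) (b := 1)).exists_bound_of_continuousOn hu.continuousOn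
  refine ⟨M, fun x => ?_⟩
  have := hp (fun i => Int.fract (x i)) (fun i => ⌊x i⌋)
  have h2 : ((fun i => Int.fract (x i)) + fun i => ((⌊x i⌋ : ℤ) : ℝ)) = x := by
    ext i; simp [Int.fract_add_floor]
  rw [h2] at this
  rw [this]
  exact hM _ ⟨fun i => Int.fract_nonneg _, fun i => (Int.fract_lt_one _).le⟩

/-- The linear form `x ↦ 2π k·x`. -/
noncomputable def linForm {n : ℕ} (k : Fin n → ℤ) : (Fin n → ℝ) →L[ℝ] ℝ :=
  ∑ i, (2 * Real.pi * (k i : ℝ)) • ContinuousLinearMap.proj (R := ℝ) (φ := fun _ : Fin n => ℝ) i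

lemma linForm_apply {n : ℕ} (k : Fin n → ℤ) (x : Fin n → ℝ) :
    linForm k x = 2 * Real.pi * ∑ i, (k i : ℝ) * x i := by
  simp [linForm, Finset.mul_sum, mul_assoc]

lemma linForm_norm {n : ℕ} (k : Fin n → ℤ) :
    ‖linForm k‖ ≤ 2 * Real.pi * n * ‖((fun i => (k i : ℝ)) : Fin n → ℝ)‖ := by
  refine ContinuousLinearMap.opNorm_le_bound _ (by positivity) fun x => ?_
  rw [linForm_apply, norm_mul, Real.norm_of_nonneg (by positivity : 0 ≤ 2 * Real.pi), mul_assoc (2 * Real.pi), mul_assoc (2 * Real.pi)]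
  refine mul_le_mul_of_nonneg_left ?_ (by positivity)
  calc ‖∑ i, (k i : ℝ) * x i‖ ≤ ∑ i : Fin n, ‖((fun i => (k i : ℝ)) : Fin n → ℝ)‖ * ‖x‖ := by
        refine norm_sum_le_of_le _ fun i _ => ?_
        rw [norm_mul]
        exact mul_le_mul (norm_le_pi_norm (fun i => (k i : ℝ)) i) (norm_le_pi_norm x i) (norm_nonneg _) (norm_nonneg _)
    _ = _ := by simp [mul_assoc]

lemma cos_periodic {n : ℕ} (k l : Fin n → ℤ) (x : Fin n → ℝ) :
    Real.cos (linForm k (x + fun i => (l i : ℝ))) = Real.cos (linForm k x) := by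
  rw [map_add]
  have : linForm k (fun i => (l i : ℝ)) = (∑ i, k i * l i : ℤ) * (2 * Real.pi) := by
    rw [linForm_apply]; push_cast; ring
  rw [this, Real.cos_add_int_mul_two_pi]

lemma iter_bound {n : ℕ} (k : Fin n → ℤ) (a : ℝ) (ha : 0 ≤ a) (i : ℕ) (x : Fin n → ℝ) :
    ‖iteratedFDeriv ℝ i (fun x => a * Real.cos (linForm k x)) x‖ ≤ a * ‖linForm k‖ ^ i := by
  have h : ContDiff ℝ i (Real.cos ∘ linForm k) := Real.contDiff_cos.comp (linForm k).contDiff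
  have : (fun x => a * Real.cos (linForm k x)) = a • (Real.cos ∘ linForm k) := rfl
  rw [this, iteratedFDeriv_const_smul_apply h.contDiffAt, norm_smul, Real.norm_of_nonneg ha]
  gcongr
  rw [ContinuousLinearMap.iteratedFDeriv_comp_right (n := i) _ Real.contDiff_cos _ le_rfl]
  refine (ContinuousMultilinearMap.norm_compContinuousLinearMap_le _ _).trans ?_
  rw [norm_iteratedFDeriv_eq_norm_iteratedDeriv]
  simp only [Finset.prod_const, Finset.card_univ, Fintype.card_fin]
  exact mul_le_of_le_one_left (by positivity) (Real.abs_iteratedDeriv_cos_le_one _ _)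

lemma hasDerivAt_line {n : ℕ} (u : (Fin n → ℝ) → ℝ) (hu : ContDiff ℝ (⊤ : ℕ∞) u) (α x : Fin n → ℝ) (t : ℝ) :
    HasDerivAt (fun t : ℝ => u (x + t • α)) (fderiv ℝ u (x + t • α) α) t := by
  have h1 : HasDerivAt (fun t : ℝ => x + t • α) α t := by
    simpa using ((hasDerivAt_id t).smul_const α).const_add x
  exact ((hu.differentiable (by simp)) (x + t • α)).hasFDerivAt.comp_hasDerivAt t h1

theorem stmt14 (n : ℕ) (hn : 1 ≤ n) (α : Fin n → ℝ)
    (hCF : ∀ f : (Fin n → ℝ) → ℝ, ContDiff ℝ (⊤ : ℕ∞) f →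
      (∀ (x : Fin n → ℝ) (k : Fin n → ℤ), f (x + fun i => (k i : ℝ)) = f x) →
      ∃ c : ℝ, ∃ u : (Fin n → ℝ) → ℝ, ContDiff ℝ (⊤ : ℕ∞) u ∧
        (∀ (x : Fin n → ℝ) (k : Fin n → ℤ), u (x + fun i => (k i : ℝ)) = u x) ∧
        ∀ x, fderiv ℝ u x α = f x - c) :
    ∃ C : ℝ, ∃ γ : ℝ, 0 < C ∧ 0 < γ ∧ ∀ k : Fin n → ℤ, k ≠ 0 →
      C / ‖((fun i => (k i : ℝ)) : Fin n → ℝ)‖ ^ γ ≤ |∑ i, (k i : ℝ) * α i| := by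
  -- nonresonance
  have hnr : ∀ k : Fin n → ℤ, k ≠ 0 → ∑ i, (k i : ℝ) * α i ≠ 0 := by
    intro k hk h0
    obtain ⟨c, u, hu, hup, hD⟩ := hCF (fun x => Real.cos (linForm k x))
      (Real.contDiff_cos.comp (linForm k).contDiff) (fun x l => cos_periodic k l x)
    obtain ⟨M, hM⟩ := bdd_periodic n u hu.continuous hup
    have hα : linForm k α = 0 := by rw [linForm_apply, h0, mul_zero]
    have hc : ∀ x, Real.cos (linForm k x) = c := by
      intro x
      by_contra hne
      have hd : ∀ t : ℝ, HasDerivAt (fun t : ℝ => u (x + t • α) - t * (Real.cos (linForm k x) - c)) 0 t := by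
        intro t
        have := (hasDerivAt_line u hu α x t).fun_sub ((hasDerivAt_id t).mul_const (Real.cos (linForm k x) - c))
        rw [hD] at this
        simpa [hα] using this
      have hcst := fun t => is_const_of_deriv_eq_zero (fun t => (hd t).differentiableAt) (fun t => (hd t).deriv) t 0
      set d := Real.cos (linForm k x) - c with hd'
      have hd0 : d ≠ 0 := sub_ne_zero.2 hne
      have := hcst ((2 * M + 1) / d)
      rw [div_mul_cancel₀ _ hd0] at this
      have h1 := abs_le.1 (hM (x + ((2 * M + 1) / d) • α))
      have h2 := abs_le.1 (hM (x + (0:ℝ) • α))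
      linarith
    obtain ⟨i, hi⟩ := Function.ne_iff.1 hk
    have hi' : (k i : ℝ) ≠ 0 := by exact_mod_cast hi
    have e0 := hc 0
    have e1 := hc (Pi.single i (1 / (2 * (k i : ℝ))))
    rw [map_zero, Real.cos_zero] at e0
    have : linForm k (Pi.single i (1 / (2 * (k i : ℝ)))) = Real.pi := by
      rw [linForm_apply]
      simp only [Pi.single_apply, mul_ite, mul_zero, Finset.sum_ite_eq', Finset.mem_univ, if_true]
      field_simp
    rw [this, Real.cos_pi] at e1
    linarith
  by_contra hcon
  push Not at hcon
  have hcon' : ∀ m : ℕ, ∃ k : Fin n → ℤ, k ≠ 0 ∧ |∑ i, (k i : ℝ) * α i| <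
      (1 / 2) ^ m / ‖((fun i => (k i : ℝ)) : Fin n → ℝ)‖ ^ (m + 1) := by
    intro m
    obtain ⟨k, hk, h⟩ := hcon ((1 / 2) ^ m) ((m + 1 : ℕ) : ℝ) (by positivity) (by positivity)
    rw [Real.rpow_natCast] at h
    exact ⟨k, hk, h⟩
  choose k hk hlt using hcon'
  set K : ℕ → ℝ := fun m => ‖((fun i => (k m i : ℝ)) : Fin n → ℝ)‖ with hK
  have hK1 : ∀ m, 1 ≤ K m := by
    intro m
    obtain ⟨i, hi⟩ := Function.ne_iff.1 (hk m)
    refine le_trans ?_ (norm_le_pi_norm (fun i => (k m i : ℝ)) i)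
    rw [Real.norm_eq_abs]
    exact_mod_cast Int.one_le_abs hi
  have hK0 : ∀ m, 0 < K m := fun m => one_pos.trans_le (hK1 m)
  set a : ℕ → ℝ := fun m => m * ((1 / 2) ^ m / K m ^ (m + 1)) with ha
  have ha0 : ∀ m, 0 ≤ a m := fun m => by have := hK0 m; positivity
  have hgeo : Summable (fun m : ℕ => (m : ℝ) * (1 / 2) ^ m) := by
    simpa using summable_pow_mul_geometric_of_norm_lt_one 1 (r := (1 / 2 : ℝ)) (by norm_num)
  have hsum : ∀ i : ℕ, Summable (fun m => a m * ‖linForm (k m)‖ ^ i) := by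
    intro i
    refine Summable.of_norm_bounded_eventually_nat (hgeo.mul_right ((2 * Real.pi * n) ^ i)) ?_
    filter_upwards [eventually_ge_atTop i] with m hm
    have h0 := hK0 m
    rw [Real.norm_of_nonneg (mul_nonneg (ha0 m) (by positivity))]
    calc a m * ‖linForm (k m)‖ ^ i ≤ a m * (2 * Real.pi * n * K m) ^ i := by
          have := ha0 m
          gcongr
          exact linForm_norm (k m)
      _ = m * (1 / 2) ^ m * (2 * Real.pi * n) ^ i * (K m ^ i / K m ^ (m + 1)) := by
          simp only [ha]; rw [mul_pow _ (K m)]; ring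
      _ ≤ m * (1 / 2) ^ m * (2 * Real.pi * n) ^ i * 1 := by
          gcongr
          rw [div_le_one (by positivity)]
          exact pow_le_pow_right₀ (hK1 m) (by omega)
      _ = _ := mul_one _
  obtain ⟨c, u, hu, hup, hD⟩ := hCF (fun x => ∑' m, a m * Real.cos (linForm (k m) x))
    (contDiff_tsum (v := fun i m => a m * ‖linForm (k m)‖ ^ i)
      (fun m => contDiff_const.mul (Real.contDiff_cos.comp (linForm (k m)).contDiff))
      (fun i _ => hsum i) (fun i m x _ => iter_bound _ _ (ha0 m) _ _))
    (fun x l => by simp_rw [cos_periodic])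
  obtain ⟨M, hM⟩ := bdd_periodic n u hu.continuous hup
  have hkey := key a ha0 (by simpa using hsum 0) (fun m => linForm (k m) α) c M (fun t => u (0 + t • α))
    (fun t => by
      have := hasDerivAt_line u hu α 0 t
      rw [hD] at this
      simpa [mul_comm] using this)
    (fun t => hM _)
  have hM0 : 0 ≤ M := (abs_nonneg _).trans (hM 0)
  obtain ⟨m, hm⟩ := exists_nat_gt (4 * Real.pi * M)
  have h1 := hkey m (by
    simp only [linForm_apply]
    exact mul_ne_zero (by positivity) (hnr _ (hk m)))
  simp only [linForm_apply] at h1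
  rw [abs_mul, abs_of_pos (by positivity : 0 < 2 * Real.pi)] at h1
  have h2 := hlt m
  have hb : 0 < (1 / 2 : ℝ) ^ m / K m ^ (m + 1) := by have := hK0 m; positivity
  have h3 : 2 * Real.pi * |∑ i, (k m i : ℝ) * α i| * M ≤ 2 * Real.pi * ((1 / 2 : ℝ) ^ m / K m ^ (m + 1)) * M := by
    gcongr
  have h4 : (4 * Real.pi * M) * ((1 / 2 : ℝ) ^ m / K m ^ (m + 1)) < m * ((1 / 2 : ℝ) ^ m / K m ^ (m + 1)) :=
    mul_lt_mul_of_pos_right hm hb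
  simp only [ha] at h1
  linarith
end
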